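/- Suppose ψ₀ is a nontrivial solution on (r₊, ∞) of the stationary ODE (r²Ω_M²ψ₀')' = ((-Λ/3)α - q₀²A²/Ω_M²) r² ψ₀ with Dirichlet boundary condition at infinity and regular at r₊, for sub-extremal parameters (M_c, r₊, Λ, α, q₀). If a one-parameter family ψ_M of such solutions with the same horizon regularity satisfies ∂B/∂M = 0 at M = M_c (where B is the Neumann coefficient in ψ = A u_D + B u_N), then multiplying the M-differentiated equation by ψ̄₀ and integrating by parts yields 0 = ∫_{r₊}^∞ r² (∂Ω_M²/∂M)|ψ₀'|² - ∂/∂M(q₀²A²/Ω_M²) r² |ψ₀|² dr; since ∂Ω_M²/∂M < 0 and -∂/∂M(q₀²A²/Ω_M²) ≤ 0 on (r₊, ∞), this forces ψ₀ ≡ 0, a contradiction. Hence ∂B/∂M ≠ 0 at (M_c, ω = 0). -/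

import Mathlib

open MeasureTheory Set Filter Topology Real

/-- Charge squared `e_M²` as a function of the mass `M` (with `r₊` a fixed root). -/
noncomputable def e2fun (rp Λ M : ℝ) : ℝ :=
  -rp ^ 2 * (1 - 2 * M / rp + (-Λ / 3) * rp ^ 2)

/-- RN–AdS lapse `Ω_M²`, parametrized by `(M, r₊, Λ)`. -/
noncomputable def Om2 (rp Λ M r : ℝ) : ℝ :=
  1 - 2 * M / r + e2fun rp Λ M / r ^ 2 + (-Λ / 3) * r ^ 2

section Aux

lemma cmp_aux {a : ℝ} {G Φ G' Φ' : ℝ → ℝ}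
    (hG : ∀ r, a < r → HasDerivAt G (G' r) r) (hΦ : ∀ r, a < r → HasDerivAt Φ (Φ' r) r)
    {x y : ℝ} (h : ∀ r, x < r → r < y → |G' r| ≤ Φ' r) (hx : a < x) (hxy : x ≤ y) :
    |G y - G x| ≤ Φ y - Φ x := by
  have key : ∀ σ : ℝ, |σ| = 1 → σ * (G y - G x) ≤ Φ y - Φ x := by
    intro σ hσ
    have hd : ∀ r, a < r → HasDerivAt (fun r => Φ r - σ * G r) (Φ' r - σ * G' r) r :=
      fun r hr => (hΦ r hr).sub ((hG r hr).const_mul σ)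
    have hm : MonotoneOn (fun r => Φ r - σ * G r) (Icc x y) := by
      apply monotoneOn_of_deriv_nonneg (convex_Icc x y)
      · intro r hr
        exact (hd r (lt_of_lt_of_le hx hr.1)).continuousAt.continuousWithinAt
      · intro r hr
        rw [interior_Icc] at hr
        exact (hd r (hx.trans hr.1)).differentiableAt.differentiableWithinAt
      · intro r hr
        rw [interior_Icc] at hr
        rw [(hd r (hx.trans hr.1)).deriv]
        have h1 := h r hr.1 hr.2
        have h2 : σ * G' r ≤ |G' r| := by
          calc σ * G' r ≤ |σ * G' r| := le_abs_self _
            _ = |G' r| := by rw [abs_mul, hσ, one_mul]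
        linarith
    have := hm (left_mem_Icc.2 hxy) (right_mem_Icc.2 hxy) hxy
    simp only at this
    linarith
  have h1 := key 1 (by simp)
  have h2 := key (-1) (by simp)
  rw [abs_le]; constructor <;> linarith

lemma cmp_left {a : ℝ} {G Φ G' Φ' : ℝ → ℝ}
    (hG : ∀ r, a < r → HasDerivAt G (G' r) r) (hΦ : ∀ r, a < r → HasDerivAt Φ (Φ' r) r)
    {y : ℝ} (h : ∀ r, a < r → r < y → |G' r| ≤ Φ' r) (hy : a < y)
    {G0 Φ0 : ℝ} (hG0 : Tendsto G (𝓝[>] a) (𝓝 G0)) (hΦ0 : Tendsto Φ (𝓝[>] a) (𝓝 Φ0)) :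
    |G y - G0| ≤ Φ y - Φ0 := by
  refine le_of_tendsto_of_tendsto ((tendsto_const_nhds.sub hG0).abs)
    (tendsto_const_nhds.sub hΦ0) ?_
  filter_upwards [Ioo_mem_nhdsGT hy] with x hx
  exact cmp_aux hG hΦ (fun r hr hr2 => h r (hx.1.trans hr) hr2) hx.1 hx.2.le

lemma cmp_right {a : ℝ} {G Φ G' Φ' : ℝ → ℝ}
    (hG : ∀ r, a < r → HasDerivAt G (G' r) r) (hΦ : ∀ r, a < r → HasDerivAt Φ (Φ' r) r)
    (h : ∀ r, a < r → |G' r| ≤ Φ' r) {x : ℝ} (hx : a < x)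
    {G0 Φ0 : ℝ} (hG0 : Tendsto G atTop (𝓝 G0)) (hΦ0 : Tendsto Φ atTop (𝓝 Φ0)) :
    |G0 - G x| ≤ Φ0 - Φ x := by
  refine le_of_tendsto_of_tendsto ((hG0.sub tendsto_const_nhds).abs)
    (hΦ0.sub tendsto_const_nhds) ?_
  filter_upwards [eventually_ge_atTop x] with y hy
  exact cmp_aux hG hΦ (fun r hr _ => h r (hx.trans hr)) hx hy

lemma bdd_of_ends {a : ℝ} {f : ℝ → ℝ} (hc : ContinuousOn f (Ioi a)) {L B : ℝ}
    (hL : Tendsto f (𝓝[>] a) (𝓝 L)) (hB : Tendsto f atTop (𝓝 B)) :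
    ∃ C, ∀ r, a < r → |f r| ≤ C := by
  have h1 : ∀ᶠ r in 𝓝[>] a, |f r| < |L| + 1 := (hL.abs).eventually (gt_mem_nhds (by linarith))
  have h2 : ∀ᶠ r in atTop, |f r| < |B| + 1 := (hB.abs).eventually (gt_mem_nhds (by linarith))
  obtain ⟨x, hx, h1⟩ := (mem_nhdsGT_iff_exists_Ioo_subset).1 h1
  obtain ⟨y, h2⟩ := eventually_atTop.1 h2
  obtain ⟨C, hC⟩ := (isCompact_Icc (a := x) (b := y)).exists_bound_of_continuousOn
    (hc.mono (fun r hr => lt_of_lt_of_le hx hr.1))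
  refine ⟨max (|L| + 1) (max (|B| + 1) C), fun r hr => ?_⟩
  rcases lt_or_ge r x with h | h
  · exact (h1 ⟨hr, h⟩ : |f r| < |L| + 1).le.trans (le_max_left _ _)
  rcases lt_or_ge y r with h' | h'
  · exact (h2 r h'.le).le.trans ((le_max_left _ _).trans (le_max_right _ _))
  · exact (hC r ⟨h, h'⟩).trans ((le_max_right _ _).trans (le_max_right _ _))

/-- vanishing flux at the horizon -/
lemma flux_zero {a : ℝ} {f g p Q : ℝ → ℝ}
    (hf : ∀ r, a < r → HasDerivAt f (g r / p r) r)
    (hg : ∀ r, a < r → HasDerivAt g (Q r * f r) r)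
    {Cp : ℝ} (hp0 : ∀ r, a < r → 0 < p r) (hp : ∀ r, a < r → r < a + 1 → p r ≤ Cp * (r - a))
    {N : ℝ} (hQf : ∀ r, a < r → r < a + 1 → |Q r * f r| ≤ N)
    {L : ℝ} (hL : Tendsto f (𝓝[>] a) (𝓝 L)) : Tendsto g (𝓝[>] a) (𝓝 0) := by
  have hCp : 0 ≤ Cp := by
    have h1 := hp (a + 1/2) (by linarith) (by linarith)
    have h2 := hp0 (a + 1/2) (by linarith)
    nlinarith
  have ht : Tendsto (fun r => 2 * r - a) (𝓝[>] a) (𝓝[>] a) := by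
    apply tendsto_nhdsWithin_of_tendsto_nhds_of_eventually_within
    · have : Tendsto (fun r : ℝ => 2 * r - a) (𝓝 a) (𝓝 (2 * a - a)) :=
        (Continuous.tendsto (by fun_prop) a)
      rw [show 2 * a - a = a by ring] at this
      exact this.mono_left nhdsWithin_le_nhds
    · filter_upwards [self_mem_nhdsWithin] with r hr
      simp only [mem_Ioi] at *; linarith
  have hlim : Tendsto (fun r => 2 * Cp * |f (2 * r - a) - f r| + N * (r - a)) (𝓝[>] a) (𝓝 0) := by
    have h1 := ((hL.comp ht).sub hL).abs.const_mul (2 * Cp)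
    have h2 : Tendsto (fun r => N * (r - a)) (𝓝[>] a) (𝓝 (N * (a - a))) :=
      (Continuous.tendsto (by fun_prop) a).mono_left nhdsWithin_le_nhds
    have := h1.add h2
    simpa using this
  apply squeeze_zero_norm' _ hlim
  have : a < a + 1/2 := by linarith
  filter_upwards [Ioo_mem_nhdsGT this] with r hr
  obtain ⟨hr1, hr2⟩ := hr
  obtain ⟨ξ, hξ, hξe⟩ := exists_hasDerivAt_eq_slope f (fun r => g r / p r)
    (show r < 2 * r - a by linarith)
    (fun t ht => (hf t (lt_of_lt_of_le hr1 ht.1)).continuousAt.continuousWithinAt)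
    (fun t ht => hf t (hr1.trans ht.1))
  have hξ1 : a < ξ := hr1.trans hξ.1
  have hpξ := hp0 ξ hξ1
  have hpξ2 := hp ξ hξ1 (by linarith [hξ.2])
  have hgξ : |g ξ| ≤ 2 * Cp * |f (2 * r - a) - f r| := by
    have h1 : g ξ = p ξ * ((f (2 * r - a) - f r) / (r - a)) := by
      have : (2 * r - a - r) = r - a := by ring
      rw [this] at hξe
      rw [← hξe]; field_simp
    rw [h1, abs_mul, abs_div, abs_of_pos hpξ, abs_of_pos (sub_pos.2 hr1), mul_div_assoc',
      div_le_iff₀ (sub_pos.2 hr1)]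
    have : p ξ ≤ 2 * Cp * (r - a) := by
      have := hξ.2
      nlinarith
    calc p ξ * |f (2 * r - a) - f r| ≤ 2 * Cp * (r - a) * |f (2 * r - a) - f r| := by gcongr
      _ = _ := by ring
  have hlip : |g ξ - g r| ≤ N * ξ - N * r := by
    refine cmp_aux (Φ := fun r => N * r) (Φ' := fun _ => N) hg
      (fun t _ => by simpa using (hasDerivAt_id t).const_mul N) ?_ hr1 hξ.1.le
    intro t ht1 ht2
    exact hQf t (hr1.trans ht1) (by linarith [hξ.2])
  have hN : 0 ≤ N := (abs_nonneg _).trans (hQf r hr1 (by linarith))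
  have h3 : N * ξ - N * r ≤ N * (r - a) := by
    have := hξ.2
    nlinarith
  have h4 : |g r| ≤ |g ξ| + |g ξ - g r| := by
    have := abs_sub_abs_le_abs_sub (g r) (g ξ)
    rw [abs_sub_comm (g r)] at this; linarith
  rw [Real.norm_eq_abs]
  linarith

noncomputable def Efun (a β κ r : ℝ) : ℝ := Real.exp (κ / β * (a ^ (-2 * β) - r ^ (-2 * β)))

lemma Efun_deriv {a β κ r : ℝ} (hβ : 0 < β) (hr : 0 < r) :
    HasDerivAt (Efun a β κ) (2 * κ * r ^ (-1 - 2 * β) * Efun a β κ r) r := by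
  have h1 : HasDerivAt (fun r : ℝ => r ^ (-2 * β)) ((-2 * β) * r ^ (-2 * β - 1)) r :=
    Real.hasDerivAt_rpow_const (Or.inl hr.ne')
  have h2 := ((h1.const_sub (a ^ (-2 * β))).const_mul (κ / β)).exp
  refine h2.congr_deriv ?_
  unfold Efun
  rw [show -2 * β - 1 = -1 - 2 * β by ring]
  field_simp

lemma Efun_one_le {a β κ r : ℝ} (hβ : 0 < β) (hκ : 0 ≤ κ) (ha : 0 < a) (hr : a ≤ r) :
    1 ≤ Efun a β κ r := by
  unfold Efun
  apply Real.one_le_exp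
  have : r ^ (-2 * β) ≤ a ^ (-2 * β) := Real.rpow_le_rpow_of_nonpos ha hr (by linarith)
  have := sub_nonneg.2 this
  positivity

lemma Efun_mono {a β κ r t : ℝ} (hβ : 0 < β) (hκ : 0 ≤ κ) (ht : 0 < t) (hr : t ≤ r) :
    Efun a β κ t ≤ Efun a β κ r := by
  unfold Efun
  apply Real.exp_le_exp.2
  have : r ^ (-2 * β) ≤ t ^ (-2 * β) := Real.rpow_le_rpow_of_nonpos ht hr (by linarith)
  have : 0 ≤ κ / β := by positivity
  gcongr

lemma Efun_le {a β κ r : ℝ} (hβ : 0 < β) (hκ : 0 ≤ κ) (hr : 0 < r) :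
    Efun a β κ r ≤ Real.exp (κ / β * a ^ (-2 * β)) := by
  unfold Efun
  apply Real.exp_le_exp.2
  have : 0 ≤ r ^ (-2 * β) := by positivity
  have : 0 ≤ κ / β := by positivity
  gcongr
  linarith

lemma Efun_tendsto {a β κ : ℝ} (hβ : 0 < β) (ha : 0 < a) :
    Tendsto (Efun a β κ) (𝓝[>] a) (𝓝 1) := by
  have h := (Efun_deriv (a := a) (κ := κ) hβ ha).continuousAt.tendsto
  rw [show Efun a β κ a = 1 by simp [Efun]] at h
  exact h.mono_left nhdsWithin_le_nhds

lemma rpow_diff_le {a r β : ℝ} (ha : 0 < a) (hr : a ≤ r) (_hβ : 0 < β) (hβ1 : β < 1) :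
    r ^ β - a ^ β ≤ (r - a) * r ^ (β - 1) := by
  have hr0 : 0 < r := lt_of_lt_of_le ha hr
  have h1 : a ^ (β - 1) ≥ r ^ (β - 1) := Real.rpow_le_rpow_of_nonpos ha hr (by linarith)
  have h2 : r ^ β = r ^ (β - 1) * r := by
    rw [Real.rpow_sub_one hr0.ne']; field_simp
  have h3 : a ^ β = a ^ (β - 1) * a := by
    rw [Real.rpow_sub_one ha.ne']; field_simp
  rw [h2, h3]; nlinarith

lemma main_bounds {a β K c : ℝ} (ha : 0 < a) (hβ : 0 < β) (hβ1 : β < 1) (hK : 0 ≤ K) (hc : 0 < c)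
    {f g p Q : ℝ → ℝ}
    (hf : ∀ r, a < r → HasDerivAt f (g r / p r) r)
    (hg : ∀ r, a < r → HasDerivAt g (Q r * f r) r)
    {Cp : ℝ} (hp : ∀ r, a < r → c * (r - a) * r ^ (3 * β) ≤ p r)
    (hp2 : ∀ r, a < r → r < a + 1 → p r ≤ Cp * (r - a))
    (hQ : ∀ r, a < r → |Q r| ≤ K * r ^ (β - 1))
    {L B : ℝ} (hL : Tendsto f (𝓝[>] a) (𝓝 L)) (hB : Tendsto f atTop (𝓝 B)) :
    Tendsto g (𝓝[>] a) (𝓝 0) ∧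
    ∀ r, a < r → |f r| ≤ 2 * |L| * Efun a β (K / (β * c)) r ∧
      |f r - L| ≤ |L| * (Efun a β (K / (β * c)) r - 1) ∧
      |g r| ≤ 2 * |L| * Efun a β (K / (β * c)) r * (K / β) * r ^ β ∧
      |g r / p r| ≤ 2 * |L| * Efun a β (K / (β * c)) r * (K / (β * c)) * r ^ (-1 - 2 * β) := by
  set κ := K / (β * c) with hκd
  have hκ : 0 ≤ κ := by positivity
  set E := Efun a β κ with hE
  have hE1 : ∀ r, a < r → 1 ≤ E r := fun r hr => Efun_one_le hβ hκ ha hr.le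
  have hpos : ∀ r, a < r → 0 < r := fun r hr => ha.trans hr
  have hp0 : ∀ r, a < r → 0 < p r := by
    intro r hr
    have := hpos r hr
    have := sub_pos.2 hr
    exact lt_of_lt_of_le (by positivity) (hp r hr)
  have hcont : ContinuousOn f (Ioi a) := fun r hr => (hf r hr).continuousAt.continuousWithinAt
  obtain ⟨C0, hC0⟩ := bdd_of_ends hcont hL hB
  have hC0' : 0 ≤ C0 := (abs_nonneg _).trans (hC0 (a + 1) (by linarith))
  have hg0 : Tendsto g (𝓝[>] a) (𝓝 0) := by
    apply flux_zero hf hg hp0 hp2 (N := K * a ^ (β - 1) * C0) _ hL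
    intro r hr _
    rw [abs_mul]
    have h1 : r ^ (β - 1) ≤ a ^ (β - 1) := Real.rpow_le_rpow_of_nonpos ha hr.le (by linarith)
    have := hC0 r hr
    have : |Q r| ≤ K * a ^ (β - 1) := (hQ r hr).trans (by gcongr)
    gcongr
  refine ⟨hg0, ?_⟩
  -- consequences of a bound by `C * E`
  have cons : ∀ C, 0 ≤ C → (∀ r, a < r → |f r| ≤ C * E r) → ∀ r, a < r →
      |f r - L| ≤ C / 2 * (E r - 1) ∧ |g r| ≤ C * E r * (K / β) * r ^ β ∧
      |g r / p r| ≤ C * E r * κ * r ^ (-1 - 2 * β) := by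
    intro C hC hfC
    have g1 : ∀ r, a < r → |g r| ≤ C * E r * (K / β) * (r ^ β - a ^ β) := by
      intro r hr
      have hd : ∀ t, a < t → HasDerivAt (fun t : ℝ => C * E r * (K / β) * t ^ β)
          (C * E r * K * t ^ (β - 1)) t := by
        intro t ht
        have h1 : HasDerivAt (fun r : ℝ => r ^ β) (β * t ^ (β - 1)) t :=
          Real.hasDerivAt_rpow_const (Or.inl (hpos t ht).ne')
        refine (h1.const_mul (C * E r * (K / β))).congr_deriv ?_
        field_simp
      have ht0 : Tendsto (fun t : ℝ => C * E r * (K / β) * t ^ β) (𝓝[>] a)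
          (𝓝 (C * E r * (K / β) * a ^ β)) := by
        have h1 : HasDerivAt (fun r : ℝ => r ^ β) (β * a ^ (β - 1)) a :=
          Real.hasDerivAt_rpow_const (Or.inl ha.ne')
        exact ((h1.continuousAt.tendsto).const_mul _).mono_left nhdsWithin_le_nhds
      have := cmp_left hg hd (y := r) ?_ hr hg0 ht0
      · rw [sub_zero] at this; linarith
      · intro t ht htr
        rw [abs_mul]
        have h1 := hQ t ht
        have h2 := hfC t ht
        have h3 : E t ≤ E r := Efun_mono hβ hκ (hpos t ht) htr.le
        have h0 := hpos t ht
        calc |Q t| * |f t| ≤ (K * t ^ (β - 1)) * (C * E r) := by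
              gcongr
              exact h2.trans (by gcongr)
          _ = _ := by ring
    have g2 : ∀ r, a < r → |g r / p r| ≤ C * E r * κ * r ^ (-1 - 2 * β) := by
      intro r hr
      have h0 := hpos r hr
      have hE := hE1 r hr
      rw [abs_div, abs_of_pos (hp0 r hr), div_le_iff₀ (hp0 r hr)]
      have h1 : r ^ (β - 1) = r ^ (-1 - 2 * β) * r ^ (3 * β) := by
        rw [← Real.rpow_add h0]; congr 1; ring
      calc |g r| ≤ C * E r * (K / β) * (r ^ β - a ^ β) := g1 r hr
        _ ≤ C * E r * (K / β) * ((r - a) * r ^ (β - 1)) := by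
            gcongr
            exact rpow_diff_le ha hr.le hβ hβ1
        _ = C * E r * κ * r ^ (-1 - 2 * β) * (c * (r - a) * r ^ (3 * β)) := by
            rw [h1, hκd]; field_simp
        _ ≤ _ := by
            gcongr
            exact hp r hr
    intro r hr
    refine ⟨?_, ?_, g2 r hr⟩
    · have hd : ∀ t, a < t → HasDerivAt (fun t : ℝ => C / 2 * E t)
          (C / 2 * (2 * κ * t ^ (-1 - 2 * β) * E t)) t := fun t ht =>
        (Efun_deriv hβ (hpos t ht)).const_mul (C / 2)
      have := cmp_left hf hd (y := r) ?_ hr hL ((Efun_tendsto hβ ha).const_mul (C / 2))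
      · linarith
      · intro t ht _
        refine (g2 t ht).trans (le_of_eq ?_)
        ring
    · refine (g1 r hr).trans ?_
      have h0 := hpos r hr
      have hE := hE1 r hr
      have : 0 ≤ a ^ β := by positivity
      gcongr
      linarith
  -- optimal constant
  have hbd : BddAbove ((fun r => |f r| / E r) '' Ioi a) := by
    refine ⟨C0, ?_⟩
    rintro _ ⟨r, hr, rfl⟩
    have := hE1 r hr
    simp only
    rw [div_le_iff₀ (by linarith)]
    have := hC0 r hr
    nlinarith
  set C := sSup ((fun r => |f r| / E r) '' Ioi a) with hCdef
  have hCE : ∀ r, a < r → |f r| ≤ C * E r := by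
    intro r hr
    have := hE1 r hr
    rw [← div_le_iff₀ (by linarith)]
    exact le_csSup hbd ⟨r, hr, rfl⟩
  have hCnn : 0 ≤ C := by
    have h1 := hCE (a + 1) (by linarith)
    have h2 := hE1 (a + 1) (by linarith)
    have h3 := abs_nonneg (f (a + 1))
    by_contra hneg
    push Not at hneg
    nlinarith
  have hC2 : C ≤ |L| + C / 2 := by
    apply csSup_le (Set.Nonempty.image _ ⟨a + 1, by simp⟩)
    rintro _ ⟨r, hr, rfl⟩
    have h1 := hE1 r hr
    simp only
    rw [div_le_iff₀ (by linarith)]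
    have h2 := (cons C hCnn hCE r hr).1
    have h3 : |f r| ≤ |L| + |f r - L| := by
      have := abs_sub_abs_le_abs_sub (f r) L
      linarith
    have := abs_nonneg L
    nlinarith
  have hfin : ∀ r, a < r → |f r| ≤ 2 * |L| * E r := by
    intro r hr
    have := hE1 r hr
    refine (hCE r hr).trans ?_
    gcongr
    linarith
  intro r hr
  obtain ⟨h1, h2, h3⟩ := cons (2 * |L|) (by positivity) hfin r hr
  refine ⟨hfin r hr, ?_, h2, h3⟩
  convert h1 using 2
  ring

noncomputable def Cf (l a M r : ℝ) : ℝ := l * (r ^ 3 + a * r ^ 2 + a ^ 2 * r + a ^ 3) + r + a - 2 * M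
noncomputable def ef (l a M : ℝ) : ℝ := 2 * M * a - a ^ 2 - l * a ^ 4
noncomputable def Pf (l a M r : ℝ) : ℝ := (r - a) * Cf l a M r
noncomputable def Vf (l a α q M r : ℝ) : ℝ :=
  l * α * r ^ 2 - q ^ 2 * (r - a) * ef l a M * r ^ 2 / (a ^ 2 * Cf l a M r)
noncomputable def Qf (l a q s M r : ℝ) : ℝ :=
  r ^ (-2 * s) * (s * (1 - s) + 2 * M * s ^ 2 / r - ef l a M * s * (s + 1) / r ^ 2
    - q ^ 2 * (r - a) * ef l a M * r ^ 2 / (a ^ 2 * Cf l a M r))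
noncomputable def ff (s : ℝ) (u : ℝ → ℝ) (r : ℝ) : ℝ := r ^ s * u r
noncomputable def gf (l a s M : ℝ) (u v : ℝ → ℝ) (r : ℝ) : ℝ :=
  r ^ (-s) * (Pf l a M r * v r) + s * (Pf l a M r * r ^ (-s - 1)) * u r
noncomputable def pf (l a s M r : ℝ) : ℝ := Pf l a M r * r ^ (-2 * s)

lemma Pf_eq (l a M r : ℝ) : Pf l a M r = l * r ^ 4 + r ^ 2 - 2 * M * r + ef l a M := by
  unfold Pf Cf ef; ring

lemma Pf_deriv (l a M r : ℝ) : HasDerivAt (Pf l a M) (4 * l * r ^ 3 + 2 * r - 2 * M) r := by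
  have : Pf l a M = fun r => l * r ^ 4 + r ^ 2 - 2 * M * r + ef l a M := by
    funext r; exact Pf_eq l a M r
  rw [this]
  have h := ((((hasDerivAt_pow 4 r).const_mul l).add (hasDerivAt_pow 2 r)).sub
    ((hasDerivAt_id r).const_mul (2 * M))).add_const (ef l a M)
  refine h.congr_deriv ?_
  simp; ring

lemma ff_deriv {l a s M r : ℝ} {u v : ℝ → ℝ} (hr : 0 < r) (hP : Pf l a M r ≠ 0)
    (hu : HasDerivAt u (v r) r) :
    HasDerivAt (ff s u) (gf l a s M u v r / pf l a s M r) r := by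
  have h1 : HasDerivAt (fun r : ℝ => r ^ s) (s * r ^ (s - 1)) r :=
    Real.hasDerivAt_rpow_const (Or.inl hr.ne')
  refine (h1.mul hu).congr_deriv ?_
  unfold gf pf
  rw [Real.rpow_sub_one hr.ne', Real.rpow_sub_one hr.ne',
    show -2 * s = (-s) + (-s) by ring, Real.rpow_add hr, Real.rpow_neg hr.le]
  have : 0 < r ^ s := by positivity
  field_simp
  ring

lemma gf_deriv {l a α q s M r : ℝ} {u v : ℝ → ℝ} (hr : 0 < r) (hα : α = - s * (3 - s))
    (hu : HasDerivAt u (v r) r)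
    (hv : HasDerivAt (fun t => Pf l a M t * v t) (Vf l a α q M r * u r) r) :
    HasDerivAt (gf l a s M u v) (Qf l a q s M r * ff s u r) r := by
  have h1 : HasDerivAt (fun r : ℝ => r ^ (-s)) (-s * r ^ (-s - 1)) r :=
    Real.hasDerivAt_rpow_const (Or.inl hr.ne')
  have h2 : HasDerivAt (fun r : ℝ => r ^ (-s - 1)) ((-s - 1) * r ^ (-s - 1 - 1)) r :=
    Real.hasDerivAt_rpow_const (Or.inl hr.ne')
  refine ((h1.mul hv).add ((((Pf_deriv l a M r).mul h2).const_mul s).mul hu)).congr_deriv ?_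
  unfold Qf ff Vf
  simp only [Pi.mul_apply]
  rw [Real.rpow_sub_one hr.ne' (-s - 1), Real.rpow_sub_one hr.ne' (-s),
    show -2 * s = (-s) + (-s) by ring, Real.rpow_add hr, Real.rpow_neg hr.le, Pf_eq]
  have : 0 < r ^ s := by positivity
  generalize q ^ 2 * (r - a) * ef l a M * r ^ 2 / (a ^ 2 * Cf l a M r) = Z
  subst hα
  field_simp
  ring

lemma Z_bound {l a q c e1 M r : ℝ} (ha : 0 < a) (hc : 0 < c) (hr : a < r)
    (hC : c * r ^ 3 ≤ Cf l a M r) (he : |ef l a M| ≤ e1) :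
    |q ^ 2 * (r - a) * ef l a M * r ^ 2 / (a ^ 2 * Cf l a M r)| ≤ q ^ 2 * e1 / (a ^ 2 * c) := by
  have hr0 : 0 < r := ha.trans hr
  have hC0 : 0 < Cf l a M r := lt_of_lt_of_le (by positivity) hC
  have hra := sub_pos.2 hr
  have he1 : 0 ≤ e1 := (abs_nonneg _).trans he
  rw [abs_div, abs_mul, abs_mul, abs_mul, abs_of_pos hra, abs_of_nonneg (sq_nonneg q),
    abs_of_pos (by positivity : 0 < r ^ 2), abs_of_pos (by positivity : 0 < a ^ 2 * Cf l a M r)]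
  calc q ^ 2 * (r - a) * |ef l a M| * r ^ 2 / (a ^ 2 * Cf l a M r)
      ≤ q ^ 2 * r * e1 * r ^ 2 / (a ^ 2 * (c * r ^ 3)) := by
        gcongr
        linarith
    _ = _ := by field_simp

noncomputable def Kc (a q s c e1 m1 β : ℝ) : ℝ :=
  a ^ (2 * β - 2) * (|s * (1 - s)| + 2 * m1 * s ^ 2 / a + e1 * s * (s + 1) / a ^ 2
    + q ^ 2 * e1 / (a ^ 2 * c))

lemma Kc_nonneg {a q s c e1 m1 β : ℝ} (ha : 0 < a) (hs : 0 < s) (hc : 0 < c) (he : 0 ≤ e1)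
    (hm : 0 ≤ m1) : 0 ≤ Kc a q s c e1 m1 β := by
  unfold Kc; positivity

lemma Q_bound {l a q c e1 m1 M r s β : ℝ} (ha : 0 < a) (hc : 0 < c) (hr : a < r)
    (hs : s = 3 / 2 * (1 - β)) (hβ1 : β < 1)
    (hC : c * r ^ 3 ≤ Cf l a M r) (he : |ef l a M| ≤ e1) (hm : |M| ≤ m1) :
    |Qf l a q s M r| ≤ Kc a q s c e1 m1 β * r ^ (β - 1) := by
  have hr0 : 0 < r := ha.trans hr
  have hs0 : 0 < s := by rw [hs]; linarith
  have he1 : 0 ≤ e1 := (abs_nonneg _).trans he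
  have hm1 : 0 ≤ m1 := (abs_nonneg _).trans hm
  unfold Qf Kc
  rw [abs_mul, abs_of_pos (by positivity : 0 < r ^ (-2 * s)),
    show -2 * s = (2 * β - 2) + (β - 1) by rw [hs]; ring, Real.rpow_add hr0]
  have h1 : r ^ (2 * β - 2) ≤ a ^ (2 * β - 2) :=
    Real.rpow_le_rpow_of_nonpos ha hr.le (by linarith)
  have hZ := Z_bound (q := q) ha hc hr hC he
  have hA : |2 * M * s ^ 2 / r| ≤ 2 * m1 * s ^ 2 / a := by
    rw [abs_div, abs_mul, abs_mul, abs_of_pos hr0, abs_of_pos (by positivity : 0 < s ^ 2), abs_two]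
    gcongr
  have hBb : |ef l a M * s * (s + 1) / r ^ 2| ≤ e1 * s * (s + 1) / a ^ 2 := by
    rw [abs_div, abs_mul, abs_mul, abs_of_pos hs0, abs_of_pos (by positivity : 0 < s + 1),
      abs_of_pos (by positivity : 0 < r ^ 2)]
    gcongr
  have hsum : |s * (1 - s) + 2 * M * s ^ 2 / r - ef l a M * s * (s + 1) / r ^ 2
    - q ^ 2 * (r - a) * ef l a M * r ^ 2 / (a ^ 2 * Cf l a M r)| ≤
      (|s * (1 - s)| + 2 * m1 * s ^ 2 / a + e1 * s * (s + 1) / a ^ 2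
    + q ^ 2 * e1 / (a ^ 2 * c)) := by
    refine (abs_sub _ _).trans ?_
    refine add_le_add ((abs_sub _ _).trans ?_) hZ
    refine add_le_add ((abs_add_le _ _).trans ?_) hBb
    exact add_le_add le_rfl hA
  calc _ ≤ a ^ (2 * β - 2) * r ^ (β - 1) * (|s * (1 - s)| + 2 * m1 * s ^ 2 / a + e1 * s * (s + 1) / a ^ 2
    + q ^ 2 * e1 / (a ^ 2 * c)) := by gcongr
    _ = _ := by ring

lemma pf_lower {l a c M r s β : ℝ} (ha : 0 < a) (hr : a < r)
    (hs : s = 3 / 2 * (1 - β)) (hC : c * r ^ 3 ≤ Cf l a M r) :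
    c * (r - a) * r ^ (3 * β) ≤ pf l a s M r := by
  have hr0 : 0 < r := ha.trans hr
  have hra := sub_pos.2 hr
  unfold pf Pf
  have : r ^ (3 * β) = r ^ 3 * r ^ (-2 * s) := by
    rw [← Real.rpow_natCast r 3, ← Real.rpow_add hr0]; congr 1; rw [hs]; push_cast; ring
  rw [this]
  have h0 : 0 < r ^ (-2 * s) := by positivity
  calc _ = (r - a) * (c * r ^ 3) * r ^ (-2 * s) := by ring
    _ ≤ _ := by gcongr

lemma Cf_le {l a m1 M r : ℝ} (hl : 0 < l) (ha : 0 < a) (hr : a < r) (hm : |M| ≤ m1) :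
    Cf l a M r ≤ (4 * l + 2 / a ^ 2 + 2 * m1 / a ^ 3) * r ^ 3 := by
  have hr0 : 0 < r := ha.trans hr
  have hm1 : 0 ≤ m1 := (abs_nonneg _).trans hm
  unfold Cf
  have h1 : a * r ^ 2 ≤ r ^ 3 := by
    calc a * r ^ 2 ≤ r * r ^ 2 := by gcongr
      _ = _ := by ring
  have h2 : a ^ 2 * r ≤ r ^ 3 := by
    calc a ^ 2 * r ≤ r ^ 2 * r := by gcongr
      _ = _ := by ring
  have h3 : a ^ 3 ≤ r ^ 3 := by gcongr
  have h4 : r + a ≤ 2 / a ^ 2 * r ^ 3 := by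
    rw [div_mul_eq_mul_div, le_div_iff₀ (by positivity)]
    nlinarith
  have h5 : - 2 * M ≤ 2 * m1 / a ^ 3 * r ^ 3 := by
    have : -M ≤ m1 := (neg_le_abs M).trans hm
    rw [div_mul_eq_mul_div, le_div_iff₀ (by positivity)]
    calc -2 * M * a ^ 3 ≤ 2 * m1 * a ^ 3 :=
          mul_le_mul_of_nonneg_right (by linarith) (by positivity)
      _ ≤ _ := by gcongr
  have : l * (r ^ 3 + a * r ^ 2 + a ^ 2 * r + a ^ 3) ≤ l * (4 * r ^ 3) := by gcongr; linarith
  nlinarith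

lemma pf_upper {l a m1 M s : ℝ} (hl : 0 < l) (ha : 0 < a) (hs : 0 < s) (hm : |M| ≤ m1) :
    ∃ Cp, ∀ r, a < r → r < a + 1 → pf l a s M r ≤ Cp * (r - a) := by
  refine ⟨(4 * l + 2 / a ^ 2 + 2 * m1 / a ^ 3) * (a + 1) ^ 3 * a ^ (-2 * s), fun r hr hr1 => ?_⟩
  have hm1 : 0 ≤ m1 := (abs_nonneg _).trans hm
  have hr0 : 0 < r := ha.trans hr
  have hra := sub_pos.2 hr
  unfold pf Pf
  have h1 : r ^ (-2 * s) ≤ a ^ (-2 * s) :=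
    Real.rpow_le_rpow_of_nonpos ha hr.le (by linarith)
  have h2 := Cf_le hl ha hr hm
  calc (r - a) * Cf l a M r * r ^ (-2 * s) ≤
      (r - a) * ((4 * l + 2 / a ^ 2 + 2 * m1 / a ^ 3) * (a + 1) ^ 3) * a ^ (-2 * s) := by
        have : Cf l a M r ≤ (4 * l + 2 / a ^ 2 + 2 * m1 / a ^ 3) * (a + 1) ^ 3 :=
          h2.trans (by gcongr)
        gcongr
    _ = _ := by ring

/-- Bounds for a single mass parameter. -/
lemma single {l a α q s β M c e1 m1 : ℝ} (hl : 0 < l) (ha : 0 < a) (hβ : 0 < β) (hβ1 : β < 1)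
    (hs : s = 3 / 2 * (1 - β)) (hα : α = - s * (3 - s)) (hc : 0 < c)
    (hC : ∀ r, a < r → c * r ^ 3 ≤ Cf l a M r) (he : |ef l a M| ≤ e1) (hm : |M| ≤ m1)
    {u v : ℝ → ℝ} (hu : ∀ r, a < r → HasDerivAt u (v r) r)
    (hv : ∀ r, a < r → HasDerivAt (fun t => Pf l a M t * v t) (Vf l a α q M r * u r) r)
    {L B : ℝ} (hL : Tendsto u (𝓝[>] a) (𝓝 L))
    (hB : Tendsto (fun r => r ^ s * u r) atTop (𝓝 B)) :
    ∃ L' : ℝ, Tendsto (gf l a s M u v) (𝓝[>] a) (𝓝 0) ∧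
    ∀ r, a < r → 
      HasDerivAt (ff s u) (gf l a s M u v r / pf l a s M r) r ∧
      HasDerivAt (gf l a s M u v) (Qf l a q s M r * ff s u r) r ∧
      |ff s u r| ≤ 2 * |L'| * Efun a β (Kc a q s c e1 m1 β / (β * c)) r ∧
      |ff s u r - L'| ≤ |L'| * (Efun a β (Kc a q s c e1 m1 β / (β * c)) r - 1) ∧
      |gf l a s M u v r| ≤ 2 * |L'| * Efun a β (Kc a q s c e1 m1 β / (β * c)) r
        * (Kc a q s c e1 m1 β / β) * r ^ β ∧
      |gf l a s M u v r / pf l a s M r| ≤ 2 * |L'| * Efun a β (Kc a q s c e1 m1 β / (β * c)) r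
        * (Kc a q s c e1 m1 β / (β * c)) * r ^ (-1 - 2 * β) := by
  have hs0 : 0 < s := by rw [hs]; linarith
  have he1 : 0 ≤ e1 := (abs_nonneg _).trans he
  have hm1 : 0 ≤ m1 := (abs_nonneg _).trans hm
  have hP : ∀ r, a < r → Pf l a M r ≠ 0 := by
    intro r hr
    have hr0 : 0 < r := ha.trans hr
    have hra := sub_pos.2 hr
    have : 0 < Cf l a M r := lt_of_lt_of_le (by positivity) (hC r hr)
    unfold Pf; positivity
  have hfd : ∀ r, a < r → HasDerivAt (ff s u) (gf l a s M u v r / pf l a s M r) r :=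
    fun r hr => ff_deriv (ha.trans hr) (hP r hr) (hu r hr)
  have hgd : ∀ r, a < r → HasDerivAt (gf l a s M u v) (Qf l a q s M r * ff s u r) r :=
    fun r hr => gf_deriv (ha.trans hr) hα (hu r hr) (hv r hr)
  have hL' : Tendsto (ff s u) (𝓝[>] a) (𝓝 (a ^ s * L)) := by
    have h1 : HasDerivAt (fun r : ℝ => r ^ s) (s * a ^ (s - 1)) a :=
      Real.hasDerivAt_rpow_const (Or.inl ha.ne')
    exact (h1.continuousAt.tendsto.mono_left nhdsWithin_le_nhds).mul hL
  obtain ⟨Cp, hCp⟩ := pf_upper hl ha hs0 hm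
  obtain ⟨h1, h2⟩ := main_bounds ha hβ hβ1 (Kc_nonneg ha hs0 hc he1 hm1) hc hfd hgd
    (fun r hr => pf_lower ha hr hs (hC r hr)) hCp
    (fun r hr => Q_bound (q := q) ha hc hr hs hβ1 (hC r hr) he hm) hL' hB
  exact ⟨_, h1, fun r hr => ⟨hfd r hr, hgd r hr, h2 r hr⟩⟩

structure Fam (l a α q s β Mc η c e1 m1 : ℝ) (u v : ℝ → ℝ → ℝ) (b : ℝ → ℝ) : Prop where
  hl : 0 < l
  ha : 0 < a
  hβ : 0 < β
  hβ1 : β < 1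
  hs : s = 3 / 2 * (1 - β)
  hα : α = - s * (3 - s)
  hc : 0 < c
  hη : 0 < η
  hC : ∀ M ∈ Ico Mc (Mc + η), ∀ r, a < r → c * r ^ 3 ≤ Cf l a M r
  he : ∀ M ∈ Ico Mc (Mc + η), |ef l a M| ≤ e1
  hm : ∀ M ∈ Ico Mc (Mc + η), |M| ≤ m1
  he0 : 0 ≤ ef l a Mc
  hu : ∀ M ∈ Ico Mc (Mc + η), ∀ r, a < r → HasDerivAt (u M) (v M r) r
  hv : ∀ M ∈ Ico Mc (Mc + η), ∀ r, a < r →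
    HasDerivAt (fun t => Pf l a M t * v M t) (Vf l a α q M r * u M r) r
  hL : ∀ M ∈ Ico Mc (Mc + η), ∃ L, Tendsto (u M) (𝓝[>] a) (𝓝 L)
  hB : ∀ M ∈ Ico Mc (Mc + η), Tendsto (fun r => r ^ s * u M r) atTop (𝓝 (b M))
  hcont : ∀ r, a < r → Tendsto (fun M => u M r) (𝓝[≥] Mc) (𝓝 (u Mc r))

variable {l a α q s β Mc η c e1 m1 : ℝ} {u v : ℝ → ℝ → ℝ} {b : ℝ → ℝ}

lemma Fam.hs0 (H : Fam l a α q s β Mc η c e1 m1 u v b) : 0 < s := by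
  rw [H.hs]; linarith [H.hβ1]

lemma Fam.Cpos (H : Fam l a α q s β Mc η c e1 m1 u v b) {M r : ℝ} (hM : M ∈ Ico Mc (Mc + η))
    (hr : a < r) : 0 < Cf l a M r := by
  have := H.ha.trans hr
  have := H.hc
  exact lt_of_lt_of_le (by positivity) (H.hC M hM r hr)

lemma Fam.Ppos (H : Fam l a α q s β Mc η c e1 m1 u v b) {M r : ℝ} (hM : M ∈ Ico Mc (Mc + η))
    (hr : a < r) : 0 < Pf l a M r :=
  mul_pos (sub_pos.2 hr) (H.Cpos hM hr)

lemma Fam.memMc (H : Fam l a α q s β Mc η c e1 m1 u v b) : Mc ∈ Ico Mc (Mc + η) :=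
  ⟨le_rfl, by linarith [H.hη]⟩

lemma Fam.evmem (H : Fam l a α q s β Mc η c e1 m1 u v b) : ∀ᶠ M in 𝓝[≥] Mc, M ∈ Ico Mc (Mc + η) :=
  Ico_mem_nhdsGE (by linarith [H.hη])

/-- uniform bounds -/
lemma Fam.bounds (H : Fam l a α q s β Mc η c e1 m1 u v b) :
    ∃ N : ℝ, 0 ≤ N ∧ ∀ᶠ M in 𝓝[≥] Mc, M ∈ Ico Mc (Mc + η) ∧
      Tendsto (gf l a s M (u M) (v M)) (𝓝[>] a) (𝓝 0) ∧
      ∀ r, a < r → |ff s (u M) r| ≤ N ∧ |gf l a s M (u M) (v M) r| ≤ N * r ^ β ∧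
        |gf l a s M (u M) (v M) r / pf l a s M r| ≤ N * r ^ (-1 - 2 * β) := by
  have S := fun M hM => single H.hl H.ha H.hβ H.hβ1 H.hs H.hα H.hc (H.hC M hM) (H.he M hM)
    (H.hm M hM) (H.hu M hM) (H.hv M hM) (H.hL M hM).choose_spec (H.hB M hM)
  have hK : 0 ≤ Kc a q s c e1 m1 β := Kc_nonneg H.ha H.hs0 H.hc
    ((abs_nonneg _).trans (H.he _ H.memMc)) ((abs_nonneg _).trans (H.hm _ H.memMc))
  set K := Kc a q s c e1 m1 β
  have ha := H.ha
  have hβ := H.hβ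
  have hc := H.hc
  set κ := K / (β * c) with hκd
  have hκ : 0 ≤ κ := by positivity
  obtain ⟨r1, hr1a, hr1⟩ : ∃ r1, a < r1 ∧ Efun a β κ r1 ≤ 3 / 2 := by
    have h1 : ∀ᶠ r in 𝓝[>] a, Efun a β κ r < 3 / 2 :=
      (Efun_tendsto hβ ha).eventually (gt_mem_nhds (by norm_num))
    obtain ⟨r, hr, hr2⟩ := (h1.and self_mem_nhdsWithin).exists
    exact ⟨r, hr2, hr.le⟩
  have hff : Tendsto (fun M => |ff s (u M) r1|) (𝓝[≥] Mc) (𝓝 |ff s (u Mc) r1|) :=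
    ((H.hcont r1 hr1a).const_mul _).abs
  have hev := hff.eventually (gt_mem_nhds (lt_add_one _))
  set A := 2 * (|ff s (u Mc) r1| + 1) with hA
  set D := Real.exp (κ / β * a ^ (-2 * β)) with hD
  have hA0 : 0 ≤ A := by positivity
  have hD0 : 0 ≤ D := by positivity
  refine ⟨2 * A * D * (1 + K / β + κ), by positivity, ?_⟩
  filter_upwards [hev, H.evmem] with M hM1 hM
  obtain ⟨L, hg0, hall⟩ := S M hM
  have hLA : |L| ≤ A := by
    obtain ⟨-, -, -, h, -⟩ := hall r1 hr1a
    have h2 : |L| - |ff s (u M) r1| ≤ |ff s (u M) r1 - L| := by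
      rw [abs_sub_comm]; exact abs_sub_abs_le_abs_sub _ _
    have h3 : |L| * (Efun a β κ r1 - 1) ≤ |L| * (1 / 2) := by
      gcongr; linarith
    rw [hA]; linarith
  refine ⟨hM, hg0, fun r hr => ?_⟩
  obtain ⟨-, -, h1, -, h2, h3⟩ := hall r hr
  have hr0 := ha.trans hr
  have hE : Efun a β κ r ≤ D := Efun_le hβ hκ hr0
  have hE0 : 0 ≤ Efun a β κ r := (Real.exp_pos _).le
  have hLE : 2 * |L| * Efun a β κ r ≤ 2 * A * D := by gcongr
  have hAD : 0 ≤ 2 * A * D := by positivity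
  have hkb : 0 ≤ K / β := by positivity
  refine ⟨?_, ?_, ?_⟩
  · refine h1.trans (hLE.trans ?_)
    nlinarith
  · refine h2.trans ?_
    have : 2 * |L| * Efun a β κ r * (K / β) ≤ 2 * A * D * (1 + K / β + κ) := by
      calc _ ≤ 2 * A * D * (K / β) := by gcongr
        _ ≤ _ := by gcongr; linarith
    gcongr
  · refine h3.trans ?_
    have : 2 * |L| * Efun a β κ r * κ ≤ 2 * A * D * (1 + K / β + κ) := by
      calc _ ≤ 2 * A * D * κ := by gcongr
        _ ≤ _ := by gcongr; linarith
    gcongr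

lemma Fam.fd (H : Fam l a α q s β Mc η c e1 m1 u v b) {M r : ℝ} (hM : M ∈ Ico Mc (Mc + η))
    (hr : a < r) :
    HasDerivAt (ff s (u M)) (gf l a s M (u M) (v M) r / pf l a s M r) r :=
  ff_deriv (H.ha.trans hr) (H.Ppos hM hr).ne' (H.hu M hM r hr)

lemma Fam.gd (H : Fam l a α q s β Mc η c e1 m1 u v b) {M r : ℝ} (hM : M ∈ Ico Mc (Mc + η))
    (hr : a < r) :
    HasDerivAt (gf l a s M (u M) (v M)) (Qf l a q s M r * ff s (u M) r) r :=
  gf_deriv (H.ha.trans hr) H.hα (H.hu M hM r hr) (H.hv M hM r hr)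

lemma Fam.Qcont (H : Fam l a α q s β Mc η c e1 m1 u v b) {M : ℝ} (hM : M ∈ Ico Mc (Mc + η)) :
    ContinuousOn (Qf l a q s M) (Ioi a) := by
  have ha := H.ha
  intro r hr
  have hr0 : 0 < r := ha.trans hr
  have hC := (H.Cpos hM hr).ne'
  apply ContinuousAt.continuousWithinAt
  have h1 : ContinuousAt (fun r : ℝ => r ^ (-2 * s)) r :=
    Real.continuousAt_rpow_const _ _ (Or.inl hr0.ne')
  unfold Qf
  refine h1.mul ?_
  have hCc : ContinuousAt (Cf l a M) r := by unfold Cf; fun_prop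
  refine ContinuousAt.sub (ContinuousAt.sub (ContinuousAt.add (by fun_prop) ?_) ?_) ?_
  · exact ContinuousAt.div (by fun_prop) (by fun_prop) hr0.ne'
  · exact ContinuousAt.div (by fun_prop) (by fun_prop) (by positivity)
  · exact ContinuousAt.div (by fun_prop) (by fun_prop) (by positivity)

lemma Fam.Qbd (H : Fam l a α q s β Mc η c e1 m1 u v b) {M r : ℝ} (hM : M ∈ Ico Mc (Mc + η))
    (hr : a < r) : |Qf l a q s M r| ≤ Kc a q s c e1 m1 β * r ^ (β - 1) :=
  Q_bound H.ha H.hc hr H.hs H.hβ1 (H.hC M hM r hr) (H.he M hM) (H.hm M hM)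

/-- convergence of the fluxes -/
lemma Fam.gconv (H : Fam l a α q s β Mc η c e1 m1 u v b) {r : ℝ} (hr : a < r) :
    Tendsto (fun M => gf l a s M (u M) (v M) r) (𝓝[≥] Mc) (𝓝 (gf l a s Mc (u Mc) (v Mc) r)) := by
  obtain ⟨N, hN, hb⟩ := H.bounds
  have hK : 0 ≤ Kc a q s c e1 m1 β := Kc_nonneg H.ha H.hs0 H.hc
    ((abs_nonneg _).trans (H.he _ H.memMc)) ((abs_nonneg _).trans (H.hm _ H.memMc))
  set K := Kc a q s c e1 m1 β with hKd
  have ha := H.ha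
  have hbd : ∀ M ∈ Ico Mc (Mc + η), (∀ r, a < r → |ff s (u M) r| ≤ N) → ∀ t, a < t →
      |Qf l a q s M t * ff s (u M) t| ≤ K * a ^ (β - 1) * N := by
    intro M hM hf t ht
    rw [abs_mul]
    have h1 := H.Qbd hM ht
    have h2 : t ^ (β - 1) ≤ a ^ (β - 1) :=
      Real.rpow_le_rpow_of_nonpos ha ht.le (by linarith [H.hβ1])
    have h3 : |Qf l a q s M t| ≤ K * a ^ (β - 1) := h1.trans (by gcongr)
    have := hf t ht
    gcongr
  have hct : ∀ M ∈ Ico Mc (Mc + η), ContinuousOn (fun t => Qf l a q s M t * ff s (u M) t) (Ioi a) :=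
    fun M hM => (H.Qcont hM).mul
      (fun t ht => (H.fd hM ht).continuousAt.continuousWithinAt)
  have hmeas : ∀ M ∈ Ico Mc (Mc + η), AEStronglyMeasurable (fun t => Qf l a q s M t * ff s (u M) t)
      (volume.restrict (uIoc a r)) := by
    intro M hM
    rw [uIoc_of_le hr.le]
    exact ((hct M hM).mono (fun t ht => ht.1)).aestronglyMeasurable measurableSet_Ioc
  have key : ∀ᶠ M in 𝓝[≥] Mc,
      ∫ t in a..r, Qf l a q s M t * ff s (u M) t = gf l a s M (u M) (v M) r := by
    filter_upwards [hb] with M ⟨hM, hg0, hall⟩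
    have hint : IntervalIntegrable (fun t => Qf l a q s M t * ff s (u M) t) volume a r := by
      refine (intervalIntegrable_const (c := K * a ^ (β - 1) * N)).mono_fun (hmeas M hM) ?_
      rw [uIoc_of_le hr.le, EventuallyLE, ae_restrict_iff' measurableSet_Ioc]
      refine Eventually.of_forall fun t ht => ?_
      refine le_trans ?_ (le_abs_self _)
      exact hbd M hM (fun r hr => (hall r hr).1) t ht.1
    have := intervalIntegral.integral_eq_sub_of_hasDerivAt_of_tendsto hr
      (fun t ht => H.gd hM ht.1) hint hg0
      ((H.gd hM hr).continuousAt.tendsto.mono_left nhdsWithin_le_nhds)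
    rw [this, sub_zero]
  have hlim : Tendsto (fun M => ∫ t in a..r, Qf l a q s M t * ff s (u M) t) (𝓝[≥] Mc)
      (𝓝 (∫ t in a..r, Qf l a q s Mc t * ff s (u Mc) t)) := by
    refine intervalIntegral.tendsto_integral_filter_of_dominated_convergence
      (fun _ => K * a ^ (β - 1) * N) ?_ ?_ intervalIntegrable_const ?_
    · filter_upwards [H.evmem] with M hM using hmeas M hM
    · filter_upwards [hb] with M ⟨hM, hg0, hall⟩
      refine Eventually.of_forall fun t ht => ?_
      rw [uIoc_of_le hr.le] at ht
      exact hbd M hM (fun r hr => (hall r hr).1) t ht.1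
    · refine Eventually.of_forall fun t ht => ?_
      rw [uIoc_of_le hr.le] at ht
      have hC := (H.Cpos H.memMc ht.1).ne'
      have h1 : Tendsto (fun M => Qf l a q s M t) (𝓝[≥] Mc) (𝓝 (Qf l a q s Mc t)) := by
        apply Tendsto.mono_left _ nhdsWithin_le_nhds
        apply ContinuousAt.tendsto
        unfold Qf ef
        refine continuousAt_const.mul (ContinuousAt.sub (by fun_prop) ?_)
        refine ContinuousAt.div (by fun_prop) (by unfold Cf; fun_prop) (by positivity)
      exact h1.mul ((H.hcont t ht.1).const_mul _)
  have h0 := key.self_of_nhdsWithin (self_mem_Ici)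
  rw [← h0]
  exact hlim.congr' key

lemma Fam.u_eq (H : Fam l a α q s β Mc η c e1 m1 u v b) {M r : ℝ}
    (hr : a < r) : u M r = r ^ (-s) * ff s (u M) r := by
  have hr0 := H.ha.trans hr
  unfold ff
  rw [Real.rpow_neg hr0.le]
  have : 0 < r ^ s := by positivity
  field_simp

lemma Fam.v_eq (H : Fam l a α q s β Mc η c e1 m1 u v b) {M r : ℝ} (hM : M ∈ Ico Mc (Mc + η))
    (hr : a < r) : v M r = r ^ (-s) * (gf l a s M (u M) (v M) r / pf l a s M r)
      - s * r ^ (-s - 1) * ff s (u M) r := by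
  have hr0 := H.ha.trans hr
  have hP := (H.Ppos hM hr).ne'
  unfold ff gf pf
  rw [Real.rpow_sub_one hr0.ne',
    show -2 * s = (-s) + (-s) by ring, Real.rpow_add hr0, Real.rpow_neg hr0.le]
  have : 0 < r ^ s := by positivity
  field_simp
  ring

lemma Fam.vconv (H : Fam l a α q s β Mc η c e1 m1 u v b) {r : ℝ} (hr : a < r) :
    Tendsto (fun M => v M r) (𝓝[≥] Mc) (𝓝 (v Mc r)) := by
  have hr0 := H.ha.trans hr
  have hP := (H.Ppos H.memMc hr).ne'
  rw [H.v_eq H.memMc hr]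
  have h : ∀ᶠ M in 𝓝[≥] Mc, r ^ (-s) * (gf l a s M (u M) (v M) r / pf l a s M r)
      - s * r ^ (-s - 1) * ff s (u M) r = v M r := by
    filter_upwards [H.evmem] with M hM using (H.v_eq hM hr).symm
  refine Tendsto.congr' h ?_
  refine Tendsto.sub (Tendsto.const_mul _ (Tendsto.div (H.gconv hr) ?_ ?_))
    (Tendsto.const_mul _ ((H.hcont r hr).const_mul _))
  · apply Tendsto.mono_left _ nhdsWithin_le_nhds
    apply ContinuousAt.tendsto
    unfold pf Pf Cf
    fun_prop
  · have : 0 < r ^ (-2 * s) := by positivity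
    unfold pf; positivity

noncomputable def Tf (l a q Mc M r : ℝ) : ℝ :=
  q ^ 2 * (r - a) * r ^ 2 / a ^ 2 * ((2 * a * Cf l a Mc r + 2 * ef l a Mc) / (Cf l a M r * Cf l a Mc r))

noncomputable def If (l a q Mc : ℝ) (u v : ℝ → ℝ → ℝ) (M r : ℝ) : ℝ :=
  -(Tf l a q Mc M r * u M r * u Mc r + 2 * (r - a) * v M r * v Mc r)

lemma Fam.f0 (H : Fam l a α q s β Mc η c e1 m1 u v b) (hb : b Mc = 0) :
    ∃ N : ℝ, 0 ≤ N ∧ ∀ r, a < r → |ff s (u Mc) r| ≤ N * r ^ (-2 * β) ∧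
      |gf l a s Mc (u Mc) (v Mc) r / pf l a s Mc r| ≤ N * r ^ (-1 - 2 * β) := by
  obtain ⟨N, hN, hb0⟩ := H.bounds
  obtain ⟨hM, -, hall⟩ := hb0.self_of_nhdsWithin self_mem_Ici
  have hβ := H.hβ
  refine ⟨N / (2 * β) + N, by positivity, fun r hr => ⟨?_, ?_⟩⟩
  · have hd : ∀ t, a < t → HasDerivAt (fun t : ℝ => - (N / (2 * β)) * t ^ (-2 * β))
        (N * t ^ (-1 - 2 * β)) t := by
      intro t ht
      have h1 : HasDerivAt (fun r : ℝ => r ^ (-2 * β)) ((-2 * β) * t ^ (-2 * β - 1)) t :=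
        Real.hasDerivAt_rpow_const (Or.inl (H.ha.trans ht).ne')
      refine (h1.const_mul (-(N / (2 * β)))).congr_deriv ?_
      rw [show -2 * β - 1 = -1 - 2 * β by ring]
      field_simp
    have hlim : Tendsto (fun t : ℝ => - (N / (2 * β)) * t ^ (-2 * β)) atTop (𝓝 (-(N / (2 * β)) * 0)) := by
      apply Tendsto.const_mul
      rw [show -2 * β = -(2 * β) by ring]
      exact tendsto_rpow_neg_atTop (by positivity)
    have hB := H.hB Mc hM
    have := cmp_right (fun t ht => H.fd hM ht) hd (fun t ht => (hall t ht).2.2) hr hB hlim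
    rw [hb] at this
    have hr0 := H.ha.trans hr
    have h2 : 0 ≤ N * r ^ (-2 * β) := by positivity
    rw [zero_sub, abs_neg] at this
    linarith
  · refine (hall r hr).2.2.trans ?_
    have hr0 := H.ha.trans hr
    gcongr
    have : 0 ≤ N / (2 * β) := by positivity
    linarith

lemma Fam.g0lim (H : Fam l a α q s β Mc η c e1 m1 u v b) (hb : b Mc = 0) :
    ∃ G : ℝ, Tendsto (gf l a s Mc (u Mc) (v Mc)) atTop (𝓝 G) := by
  obtain ⟨N, hN, hall⟩ := H.f0 hb
  have hK : 0 ≤ Kc a q s c e1 m1 β := Kc_nonneg H.ha H.hs0 H.hc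
    ((abs_nonneg _).trans (H.he _ H.memMc)) ((abs_nonneg _).trans (H.hm _ H.memMc))
  refine ⟨_, tendsto_limUnder_of_hasDerivAt_of_integrableOn_Ioi
    (fun t ht => H.gd H.memMc ht) ?_⟩
  have hi : IntegrableOn (fun t : ℝ => Kc a q s c e1 m1 β * N * t ^ (-1 - β)) (Ioi a) :=
    (integrableOn_Ioi_rpow_of_lt (by linarith [H.hβ]) H.ha).const_mul _
  refine Integrable.mono' hi ?_ ?_
  · exact ((H.Qcont H.memMc).mul (fun t ht =>
      (H.fd H.memMc ht).continuousAt.continuousWithinAt)).aestronglyMeasurable measurableSet_Ioi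
  · rw [ae_restrict_iff' measurableSet_Ioi]
    refine Eventually.of_forall fun t ht => ?_
    have ht0 : 0 < t := H.ha.trans ht
    rw [Real.norm_eq_abs, abs_mul]
    have h1 := H.Qbd H.memMc ht
    have h2 := (hall t ht).1
    calc _ ≤ (Kc a q s c e1 m1 β * t ^ (β - 1)) * (N * t ^ (-2 * β)) := by gcongr
      _ = Kc a q s c e1 m1 β * N * (t ^ (β - 1) * t ^ (-2 * β)) := by ring
      _ = _ := by rw [← Real.rpow_add ht0]; congr 2; ring

lemma Fam.vcont (H : Fam l a α q s β Mc η c e1 m1 u v b) {M : ℝ} (hM : M ∈ Ico Mc (Mc + η)) :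
    ContinuousOn (v M) (Ioi a) := by
  have h1 : ContinuousOn (fun t => Pf l a M t * v M t / Pf l a M t) (Ioi a) := by
    refine ContinuousOn.div (fun t ht => (H.hv M hM t ht).continuousAt.continuousWithinAt)
      (fun t _ => (Pf_deriv l a M t).continuousAt.continuousWithinAt)
      (fun t ht => (H.Ppos hM ht).ne')
  refine h1.congr fun t ht => ?_
  have := (H.Ppos hM ht).ne'
  field_simp

lemma Fam.ucont (H : Fam l a α q s β Mc η c e1 m1 u v b) {M : ℝ} (hM : M ∈ Ico Mc (Mc + η)) :
    ContinuousOn (u M) (Ioi a) :=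
  fun t ht => (H.hu M hM t ht).continuousAt.continuousWithinAt

lemma Fam.Icont (H : Fam l a α q s β Mc η c e1 m1 u v b) {M : ℝ} (hM : M ∈ Ico Mc (Mc + η)) :
    ContinuousOn (If l a q Mc u v M) (Ioi a) := by
  have hT : ContinuousOn (Tf l a q Mc M) (Ioi a) := by
    unfold Tf
    refine ContinuousOn.mul (by fun_prop) (ContinuousOn.div ?_ ?_ ?_)
    · unfold Cf; fun_prop
    · unfold Cf; fun_prop
    · intro r hr
      exact (mul_pos (H.Cpos hM hr) (H.Cpos H.memMc hr)).ne'
  have h1 := H.vcont hM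
  have h2 := H.vcont H.memMc
  have h3 := H.ucont hM
  have h4 := H.ucont H.memMc
  unfold If
  fun_prop

lemma Fam.Tbd (H : Fam l a α q s β Mc η c e1 m1 u v b) {M r : ℝ} (hM : M ∈ Ico Mc (Mc + η))
    (hr : a < r) : 0 ≤ Tf l a q Mc M r ∧
      Tf l a q Mc M r ≤ q ^ 2 / a ^ 2 * ((2 * a + 2 * ef l a Mc / (c * a ^ 3)) / c) := by
  have ha := H.ha
  have hr0 := ha.trans hr
  have hc := H.hc
  have hra := sub_pos.2 hr
  have h1 := H.Cpos hM hr
  have h2 := H.Cpos H.memMc hr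
  have h3 := H.hC M hM r hr
  have h4 := H.hC Mc H.memMc r hr
  have he := H.he0
  constructor
  · unfold Tf; positivity
  · unfold Tf
    have h5 : c * a ^ 3 ≤ Cf l a Mc r := le_trans (by gcongr) h4
    calc _ = q ^ 2 / a ^ 2 * ((r - a) * r ^ 2 * ((2 * a + 2 * ef l a Mc / Cf l a Mc r) / Cf l a M r)) := by
          field_simp
      _ ≤ q ^ 2 / a ^ 2 * (r * r ^ 2 * ((2 * a + 2 * ef l a Mc / (c * a ^ 3)) / (c * r ^ 3))) := by
          gcongr
          linarith
      _ = _ := by field_simp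

lemma Fam.Ibd (H : Fam l a α q s β Mc η c e1 m1 u v b) (hb : b Mc = 0) :
    ∃ N : ℝ, 0 ≤ N ∧ ∀ᶠ M in 𝓝[≥] Mc, ∀ r, a < r → |If l a q Mc u v M r| ≤ N * r ^ (β - 3) := by
  obtain ⟨N0, hN0, hall0⟩ := H.f0 hb
  obtain ⟨N, hN, hall⟩ := H.bounds
  have ha := H.ha
  have hs0 := H.hs0
  set τ := q ^ 2 / a ^ 2 * ((2 * a + 2 * ef l a Mc / (c * a ^ 3)) / c) with hτ
  have hτ0 : 0 ≤ τ := by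
    have := H.Tbd H.memMc (show a < a + 1 by linarith)
    exact this.1.trans this.2
  refine ⟨τ * N * N0 + 2 / a * (N * (a ^ (-2 * β) + s)) * (N0 * (1 + s)), by positivity, ?_⟩
  filter_upwards [hall] with M ⟨hM, _, hall⟩
  intro r hr
  have hr0 := ha.trans hr
  obtain ⟨hf, -, hf'⟩ := hall r hr
  obtain ⟨hf0, hf0'⟩ := hall0 r hr
  obtain ⟨hT0, hT⟩ := H.Tbd hM hr
  have hra := sub_pos.2 hr
  have hx : 0 < r ^ (-s) := by positivity
  have hu1 : |u M r| ≤ N * r ^ (-s) := by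
    rw [H.u_eq hr, abs_mul, abs_of_pos hx, mul_comm]; gcongr
  have hu0 : |u Mc r| ≤ N0 * r ^ (-2 * β) * r ^ (-s) := by
    rw [H.u_eq hr, abs_mul, abs_of_pos hx, mul_comm]; gcongr
  have e1' : r ^ (-1 - 2 * β) = r ^ (-2 * β) / r := by
    rw [show -1 - 2 * β = -2 * β - 1 by ring, Real.rpow_sub_one hr0.ne']
  have e2' : r ^ (-s - 1) = r ^ (-s) / r := Real.rpow_sub_one hr0.ne' _
  have hv1 : |v M r| ≤ N * (a ^ (-2 * β) + s) * r ^ (-s) / r := by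
    have h1 : r ^ (-2 * β) ≤ a ^ (-2 * β) :=
      Real.rpow_le_rpow_of_nonpos ha hr.le (by linarith [H.hβ])
    rw [H.v_eq hM hr]
    refine (abs_sub _ _).trans ?_
    rw [abs_mul, abs_mul, abs_of_pos hx, abs_of_pos (by positivity : 0 < s * r ^ (-s - 1)), e2']
    rw [e1'] at hf'
    calc _ ≤ r ^ (-s) * (N * (r ^ (-2 * β) / r)) + s * (r ^ (-s) / r) * N := by gcongr
      _ ≤ r ^ (-s) * (N * (a ^ (-2 * β) / r)) + s * (r ^ (-s) / r) * N := by gcongr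
      _ = _ := by field_simp
  have hv0 : |v Mc r| ≤ N0 * (1 + s) * r ^ (-2 * β) * r ^ (-s) / r := by
    rw [H.v_eq H.memMc hr]
    refine (abs_sub _ _).trans ?_
    rw [abs_mul, abs_mul, abs_of_pos hx, abs_of_pos (by positivity : 0 < s * r ^ (-s - 1)), e2']
    rw [e1'] at hf0'
    calc _ ≤ r ^ (-s) * (N0 * (r ^ (-2 * β) / r)) + s * (r ^ (-s) / r) * (N0 * r ^ (-2 * β)) := by gcongr
      _ = _ := by field_simp
  have e3 : r ^ (β - 3) = r ^ (-2 * β) * r ^ (-s) * r ^ (-s) := by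
    rw [← Real.rpow_add hr0, ← Real.rpow_add hr0]; congr 1; rw [H.hs]; ring
  unfold If
  rw [abs_neg]
  refine (abs_add_le _ _).trans ?_
  rw [add_mul]
  refine add_le_add ?_ ?_
  · rw [abs_mul, abs_mul, abs_of_nonneg hT0, e3]
    calc _ ≤ τ * (N * r ^ (-s)) * (N0 * r ^ (-2 * β) * r ^ (-s)) := by gcongr
      _ = _ := by ring
  · rw [abs_mul, abs_mul, abs_of_pos (by positivity : 0 < 2 * (r - a)), e3]
    calc _ ≤ 2 * r * (N * (a ^ (-2 * β) + s) * r ^ (-s) / r) *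
            (N0 * (1 + s) * r ^ (-2 * β) * r ^ (-s) / r) := by
          gcongr
          linarith
      _ = 2 / r * (N * (a ^ (-2 * β) + s)) * (N0 * (1 + s)) * (r ^ (-2 * β) * r ^ (-s) * r ^ (-s)) := by
          field_simp
      _ ≤ _ := by gcongr

/-- the Wronskian identity, integrated -/
lemma Fam.wronsk (H : Fam l a α q s β Mc η c e1 m1 u v b) (hb : b Mc = 0) :
    ∃ G : ℝ, ∀ᶠ M in 𝓝[≥] Mc, (M - Mc) * ∫ r in Ioi a, If l a q Mc u v M r = - G * b M := by
  obtain ⟨N0, hN0, hall0⟩ := H.f0 hb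
  obtain ⟨N, hN, hall⟩ := H.bounds
  obtain ⟨NI, hNI, hallI⟩ := H.Ibd hb
  obtain ⟨G, hG⟩ := H.g0lim hb
  obtain ⟨-, hg00, -⟩ := hall.self_of_nhdsWithin self_mem_Ici
  have ha := H.ha
  have hs0 := H.hs0
  have hβ := H.hβ
  have hff : ∀ M ∈ Ico Mc (Mc + η), ∃ L, Tendsto (ff s (u M)) (𝓝[>] a) (𝓝 L) := by
    intro M hM
    obtain ⟨L, hL⟩ := H.hL M hM
    have h1 : HasDerivAt (fun r : ℝ => r ^ s) (s * a ^ (s - 1)) a :=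
      Real.hasDerivAt_rpow_const (Or.inl ha.ne')
    exact ⟨_, (h1.continuousAt.tendsto.mono_left nhdsWithin_le_nhds).mul hL⟩
  refine ⟨G, ?_⟩
  filter_upwards [hall, hallI] with M ⟨hM, hg0, hallM⟩ hIM
  set W : ℝ → ℝ := fun r => (Pf l a M r * v M r) * u Mc r - (Pf l a Mc r * v Mc r) * u M r with hW
  have hWd : ∀ r ∈ Ioi a, HasDerivAt W ((M - Mc) * If l a q Mc u v M r) r := by
    intro r hr
    have h1 := ((H.hv M hM r hr).mul (H.hu Mc H.memMc r hr)).sub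
      ((H.hv Mc H.memMc r hr).mul (H.hu M hM r hr))
    refine h1.congr_deriv ?_
    have c1 := (H.Cpos hM hr).ne'
    have c2 := (H.Cpos H.memMc hr).ne'
    have hVd : Vf l a α q M r - Vf l a α q Mc r = -(M - Mc) * Tf l a q Mc M r := by
      have hC : Cf l a Mc r = Cf l a M r + 2 * (M - Mc) := by unfold Cf; ring
      have he : ef l a Mc = ef l a M - 2 * a * (M - Mc) := by unfold ef; ring
      unfold Vf Tf
      have c3 := c2
      rw [hC] at c3
      rw [hC, he]
      field_simp
      ring
    have hPd : Pf l a M r - Pf l a Mc r = -2 * (M - Mc) * (r - a) := by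
      unfold Pf Cf; ring
    unfold If
    linear_combination (u M r * u Mc r) * hVd + (v M r * v Mc r) * hPd
  have hWeq : ∀ r ∈ Ioi a, W r = gf l a s M (u M) (v M) r * ff s (u Mc) r
      - gf l a s Mc (u Mc) (v Mc) r * ff s (u M) r
      + 2 * (M - Mc) * s * ((1 - a / r) * r ^ (-(2 * s)) * (ff s (u M) r * ff s (u Mc) r)) := by
    intro r hr
    have hr0 : 0 < r := ha.trans hr
    have hx : 0 < r ^ s := by positivity
    have hPd : Pf l a M r = Pf l a Mc r - 2 * (M - Mc) * (r - a) := by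
      unfold Pf Cf; ring
    simp only [hW, gf, ff]
    rw [Real.rpow_sub_one hr0.ne',
      show -(2 * s) = (-s) + (-s) by ring, Real.rpow_add hr0, Real.rpow_neg hr0.le, hPd]
    field_simp
    ring
  have hW0 : Tendsto W (𝓝[>] a) (𝓝 0) := by
    obtain ⟨L1, hL1⟩ := hff M hM
    obtain ⟨L0, hL0⟩ := hff Mc H.memMc
    have h3 : Tendsto (fun r : ℝ => (1 - a / r) * r ^ (-(2 * s))) (𝓝[>] a)
        (𝓝 ((1 - a / a) * a ^ (-(2 * s)))) := by
      apply Tendsto.mono_left _ nhdsWithin_le_nhds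
      apply ContinuousAt.tendsto
      refine ContinuousAt.mul (continuousAt_const.sub
        (ContinuousAt.div continuousAt_const continuousAt_id ha.ne'))
        (Real.continuousAt_rpow_const _ _ (Or.inl ha.ne'))
    have h4 := ((hg0.mul hL0).sub (hg00.mul hL1)).add
      ((h3.mul (hL1.mul hL0)).const_mul (2 * (M - Mc) * s))
    rw [div_self ha.ne'] at h4
    simp only [sub_self, zero_mul, mul_zero, add_zero] at h4
    refine h4.congr' ?_
    filter_upwards [self_mem_nhdsWithin] with r hr using (hWeq r hr).symm
  have hWinf : Tendsto W atTop (𝓝 (- G * b M)) := by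
    have h1 : Tendsto (fun r => gf l a s M (u M) (v M) r * ff s (u Mc) r) atTop (𝓝 0) := by
      have h0 : Tendsto (fun r : ℝ => N * N0 * r ^ (-β)) atTop (𝓝 (N * N0 * 0)) :=
        (tendsto_rpow_neg_atTop hβ).const_mul _
      rw [mul_zero] at h0
      refine squeeze_zero_norm' ?_ h0
      filter_upwards [Ioi_mem_atTop a] with r hr
      have hr0 : 0 < r := ha.trans hr
      rw [Real.norm_eq_abs, abs_mul]
      have i1 := (hallM r hr).2.1
      have i2 := (hall0 r hr).1
      calc _ ≤ (N * r ^ β) * (N0 * r ^ (-2 * β)) := by gcongr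
        _ = N * N0 * (r ^ β * r ^ (-2 * β)) := by ring
        _ = _ := by rw [← Real.rpow_add hr0]; congr 2; ring
    have hB1 : Tendsto (ff s (u M)) atTop (𝓝 (b M)) := H.hB M hM
    have hB0 : Tendsto (ff s (u Mc)) atTop (𝓝 0) := hb ▸ H.hB Mc H.memMc
    have h3 : Tendsto (fun r : ℝ => (1 - a / r) * r ^ (-(2 * s))) atTop (𝓝 ((1 - 0) * 0)) :=
      (tendsto_const_nhds.sub (tendsto_const_nhds.div_atTop tendsto_id)).mul
        (tendsto_rpow_neg_atTop (by positivity))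
    have h4 := (h1.sub (hG.mul hB1)).add
      ((h3.mul (hB1.mul hB0)).const_mul (2 * (M - Mc) * s))
    simp only [mul_zero, add_zero, zero_sub] at h4
    rw [neg_mul]
    refine h4.congr' ?_
    filter_upwards [Ioi_mem_atTop a] with r hr using (hWeq r hr).symm
  have hI : IntegrableOn (If l a q Mc u v M) (Ioi a) := by
    have hi : IntegrableOn (fun t : ℝ => NI * t ^ (β - 3)) (Ioi a) :=
      (integrableOn_Ioi_rpow_of_lt (by linarith [H.hβ1]) ha).const_mul _
    refine Integrable.mono' hi ((H.Icont hM).aestronglyMeasurable measurableSet_Ioi) ?_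
    rw [ae_restrict_iff' measurableSet_Ioi]
    exact Eventually.of_forall fun t ht => hIM t ht
  have := integral_Ioi_deriv_mul_eq_sub (u := W) (v := fun _ => (1 : ℝ))
    (u' := fun r => (M - Mc) * If l a q Mc u v M r) (v' := fun _ => 0) (a := a) (a' := 0)
    (b' := - G * b M) hWd (fun x _ => hasDerivAt_const x 1)
    (by
      have : IntegrableOn (fun r => (M - Mc) * If l a q Mc u v M r) (Ioi a) := hI.const_mul (M - Mc)
      refine IntegrableOn.congr_fun this (fun r _ => ?_) measurableSet_Ioi
      simp)
    (by refine hW0.congr fun r => ?_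
        simp)
    (by refine hWinf.congr fun r => ?_
        simp)
  simp only [mul_one, mul_zero, add_zero, sub_zero] at this
  rw [← this, integral_const_mul]

lemma Fam.core (H : Fam l a α q s β Mc η c e1 m1 u v b) (hb : b Mc = 0) (hbd : HasDerivAt b 0 Mc) :
    ∀ r, a < r → u Mc r = 0 := by
  obtain ⟨G, hG⟩ := H.wronsk hb
  obtain ⟨NI, hNI, hallI⟩ := H.Ibd hb
  have ha := H.ha
  have hi : IntegrableOn (fun t : ℝ => NI * t ^ (β - 3)) (Ioi a) :=
    (integrableOn_Ioi_rpow_of_lt (by linarith [H.hβ1]) ha).const_mul _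
  have hlim : Tendsto (fun M => ∫ r in Ioi a, If l a q Mc u v M r) (𝓝[≥] Mc)
      (𝓝 (∫ r in Ioi a, If l a q Mc u v Mc r)) := by
    refine tendsto_integral_filter_of_dominated_convergence _ ?_ ?_ hi ?_
    · filter_upwards [H.evmem] with M hM
      exact (H.Icont hM).aestronglyMeasurable measurableSet_Ioi
    · filter_upwards [hallI] with M hM
      rw [ae_restrict_iff' measurableSet_Ioi]
      exact Eventually.of_forall fun t ht => hM t ht
    · rw [ae_restrict_iff' measurableSet_Ioi]
      refine Eventually.of_forall fun t ht => ?_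
      have hC := (H.Cpos H.memMc ht).ne'
      have hT : Tendsto (fun M => Tf l a q Mc M t) (𝓝[≥] Mc) (𝓝 (Tf l a q Mc Mc t)) := by
        apply Tendsto.mono_left _ nhdsWithin_le_nhds
        apply ContinuousAt.tendsto
        unfold Tf
        refine continuousAt_const.mul (ContinuousAt.div continuousAt_const ?_ (by positivity))
        unfold Cf; fun_prop
      unfold If
      exact (((hT.mul (H.hcont t ht)).mul_const _).add
        (((H.vconv ht).const_mul _).mul_const _)).neg
  have hlim' := hlim.mono_left (nhdsWithin_mono Mc Ioi_subset_Ici_self)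
  have hslope : Tendsto (fun M => - G * slope b Mc M) (𝓝[>] Mc) (𝓝 (- G * 0)) :=
    ((hasDerivAt_iff_tendsto_slope.1 hbd).mono_left
      (nhdsWithin_mono Mc (fun x hx => ne_of_gt hx))).const_mul _
  have hzero : ∫ r in Ioi a, If l a q Mc u v Mc r = 0 := by
    rw [mul_zero] at hslope
    refine tendsto_nhds_unique (hlim'.congr' ?_) hslope
    filter_upwards [hG.filter_mono (nhdsWithin_mono Mc Ioi_subset_Ici_self), self_mem_nhdsWithin]
      with M hM hM2
    have hne : M - Mc ≠ 0 := (sub_pos.2 hM2).ne'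
    rw [slope_def_field, hb, sub_zero]
    field_simp
    linarith
  have hTnn := fun r (hr : a < r) => (H.Tbd H.memMc hr).1
  have hI0 : IntegrableOn (If l a q Mc u v Mc) (Ioi a) := by
    refine Integrable.mono' hi ((H.Icont H.memMc).aestronglyMeasurable measurableSet_Ioi) ?_
    rw [ae_restrict_iff' measurableSet_Ioi]
    exact Eventually.of_forall fun t ht => hallI.self_of_nhdsWithin self_mem_Ici t ht
  have hnn : ∀ r, a < r → 0 ≤ - If l a q Mc u v Mc r := by
    intro r hr
    unfold If
    have := hTnn r hr
    have := sub_pos.2 hr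
    have h1 := mul_self_nonneg (u Mc r)
    have h2 := mul_self_nonneg (v Mc r)
    rw [neg_neg, mul_assoc, mul_assoc (2 * (r - a))]
    positivity
  have hae : (- If l a q Mc u v Mc) =ᵐ[volume.restrict (Ioi a)] 0 := by
    rw [← setIntegral_eq_zero_iff_of_nonneg_ae _ hI0.neg]
    · simp only [Pi.neg_apply]
      rw [integral_neg, hzero, neg_zero]
    · rw [EventuallyLE, ae_restrict_iff' measurableSet_Ioi]
      exact Eventually.of_forall fun t ht => hnn t ht
  have hev : EqOn (fun r => - If l a q Mc u v Mc r) 0 (Ioi a) :=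
    Measure.eqOn_open_of_ae_eq hae isOpen_Ioi (H.Icont H.memMc).neg continuousOn_const
  have hv0 : ∀ r, a < r → v Mc r = 0 := by
    intro r hr
    have h := hev hr
    simp only [If, Pi.zero_apply, neg_neg] at h
    have h1 := mul_self_nonneg (u Mc r)
    have h2 := mul_self_nonneg (v Mc r)
    have h3 := mul_nonneg (hTnn r hr) h1
    have h4 := sub_pos.2 hr
    have h5 : (r - a) * (v Mc r * v Mc r) = 0 := by
      have := mul_nonneg h4.le h2
      nlinarith
    rcases mul_eq_zero.1 h5 with h | h
    · linarith
    · exact mul_self_eq_zero.1 h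
  intro r hr
  have hconst : ∀ t, r ≤ t → u Mc t = u Mc r := by
    intro t ht
    have := cmp_aux (G := u Mc) (Φ := fun _ => (0:ℝ)) (Φ' := fun _ => 0)
      (fun t ht => H.hu Mc H.memMc t ht) (fun t _ => hasDerivAt_const t 0)
      (fun x hx _ => by rw [hv0 x (hr.trans hx)]; simp) hr ht
    rw [sub_self] at this
    have := abs_nonpos_iff.1 this
    linarith
  have h1 : Tendsto (fun t : ℝ => t ^ (-s) * (t ^ s * u Mc t)) atTop (𝓝 (0 * 0)) :=
    (tendsto_rpow_neg_atTop H.hs0).mul (hb ▸ H.hB Mc H.memMc)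
  rw [mul_zero] at h1
  refine tendsto_nhds_unique ?_ h1
  refine (tendsto_const_nhds (x := u Mc r)).congr' ?_
  filter_upwards [eventually_ge_atTop r] with t ht
  have ht0 : 0 < t := ha.trans (lt_of_lt_of_le hr ht)
  rw [← mul_assoc, ← Real.rpow_add ht0, neg_add_cancel, Real.rpow_zero, one_mul, hconst t ht]

end Aux

lemma Om2_eq {rp Λ M r : ℝ} (hrp : rp ≠ 0) (hr : r ≠ 0) :
    r ^ 2 * Om2 rp Λ M r = Pf (-Λ / 3) rp M r := by
  rw [Pf_eq]
  unfold Om2 e2fun ef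
  field_simp
  ring

lemma e2_eq {rp Λ M : ℝ} (hrp : rp ≠ 0) : e2fun rp Λ M = ef (-Λ / 3) rp M := by
  unfold e2fun ef
  field_simp
  ring

lemma V_eq {rp Λ α q M r : ℝ} (hrp : rp ≠ 0) (hr : r ≠ 0) (hra : r - rp ≠ 0)
    (hC : Cf (-Λ / 3) rp M r ≠ 0) :
    ((-Λ / 3) * α - q ^ 2 * e2fun rp Λ M * (1 / rp - 1 / r) ^ 2 / Om2 rp Λ M r) * r ^ 2
      = Vf (-Λ / 3) rp α q M r := by
  have h1 : Om2 rp Λ M r = (r - rp) * Cf (-Λ / 3) rp M r / r ^ 2 := by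
    have := Om2_eq (Λ := Λ) (M := M) hrp hr
    rw [eq_div_iff (by positivity), mul_comm, this]; rfl
  rw [h1, e2_eq hrp]
  unfold Vf
  field_simp

/-- Non-degeneracy of the Neumann coefficient: if `ψ_M` is a family of solutions of
the stationary charged Klein–Gordon ODE with parameters `M` near `M_c`, regular at
the horizon, with Neumann coefficient `B(M) = lim_{r→∞} r^{3/2-Δ} ψ_M(r)`, and
`ψ_{M_c}` is a nontrivial stationary solution with Dirichlet boundary condition
(`B(M_c) = 0`), then `∂B/∂M ≠ 0` at `M = M_c`. -/
theorem neumann_coefficient_nondegenerate (rp Λ α q0 Mc : ℝ)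
    (hrp : 0 < rp) (hΛ : Λ < 0) (hα1 : -9 / 4 < α) (hα2 : α < 0)
    (Δ : ℝ) (hΔ : Δ = Real.sqrt (9 / 4 + α))
    (hsub1 : rp / 2 * (1 + (-Λ / 3) * rp ^ 2) < Mc)
    (hsub2 : Mc < rp * (1 + 2 * (-Λ / 3) * rp ^ 2))
    (δ : ℝ) (hδ : 0 < δ)
    (ψ : ℝ → ℝ → ℂ) (B : ℝ → ℂ)
    (hsm : ∀ M ∈ Set.Ioo (Mc - δ) (Mc + δ), ContDiffOn ℝ 2 (ψ M) (Set.Ioi rp))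
    (hode : ∀ M ∈ Set.Ioo (Mc - δ) (Mc + δ), ∀ r ∈ Set.Ioi rp,
      deriv (fun s : ℝ => (s : ℂ) ^ 2 * ((Om2 rp Λ M s : ℝ) : ℂ) * deriv (ψ M) s) r
        = (((-Λ / 3) * α
            - q0 ^ 2 * e2fun rp Λ M * (1 / rp - 1 / r) ^ 2 / Om2 rp Λ M r : ℝ) : ℂ)
          * (r : ℂ) ^ 2 * ψ M r)
    (hreg : ∀ M ∈ Set.Ioo (Mc - δ) (Mc + δ),
      ∃ L : ℂ, Tendsto (ψ M) (𝓝[>] rp) (𝓝 L))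
    (hB : ∀ M ∈ Set.Ioo (Mc - δ) (Mc + δ),
      Tendsto (fun r : ℝ => (r ^ ((3 : ℝ) / 2 - Δ) : ℝ) • ψ M r) atTop (𝓝 (B M)))
    (hdiffM : ∀ r ∈ Set.Ioi rp, DifferentiableAt ℝ (fun M => ψ M r) Mc)
    (hBdiff : DifferentiableAt ℝ B Mc)
    (hstat : B Mc = 0)
    (hnt : ∃ r ∈ Set.Ioi rp, ψ Mc r ≠ 0) :
    deriv B Mc ≠ 0 := by
  intro hB0
  have hBd : HasDerivAt B 0 Mc := hB0 ▸ hBdiff.hasDerivAt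
  set l := -Λ / 3 with hl
  have hl0 : 0 < l := by rw [hl]; linarith
  have hΔ0 : 0 < Δ := by rw [hΔ]; exact Real.sqrt_pos.2 (by linarith)
  have hΔ2 : Δ ^ 2 = 9 / 4 + α := by rw [hΔ]; exact Real.sq_sqrt (by linarith)
  have hΔ1 : Δ < 3 / 2 := by nlinarith
  set k := rp * (1 + 2 * l * rp ^ 2) - Mc with hk
  have hk0 : 0 < k := by rw [hk]; linarith
  set η := min δ (k / 2) with hη
  have hη0 : 0 < η := lt_min hδ (by linarith)
  have hηδ : η ≤ δ := min_le_left _ _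
  have hηk : η ≤ k / 2 := min_le_right _ _
  have hmem : ∀ M ∈ Ico Mc (Mc + η), M ∈ Ioo (Mc - δ) (Mc + δ) := fun M hM =>
    ⟨by linarith [hM.1], by linarith [hM.2]⟩
  have hc0 : 0 < min l (k / rp ^ 3) := lt_min hl0 (by positivity)
  have hC : ∀ M ∈ Ico Mc (Mc + η), ∀ r, rp < r → min l (k / rp ^ 3) * r ^ 3 ≤ Cf l rp M r := by
    intro M hM r hr
    have hr0 := hrp.trans hr
    set c := min l (k / rp ^ 3)
    have h1 : c ≤ l := min_le_left _ _
    have h2 : c * rp ^ 3 ≤ k := by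
      rw [← le_div_iff₀ (by positivity)]; exact min_le_right _ _
    have h3 : rp ^ 3 ≤ r ^ 3 := by gcongr
    have h4 : rp ^ 3 ≤ rp * r ^ 2 := by
      calc rp ^ 3 = rp * rp ^ 2 := by ring
        _ ≤ _ := by gcongr
    have h5 : rp ^ 3 ≤ rp ^ 2 * r := by
      calc rp ^ 3 = rp ^ 2 * rp := by ring
        _ ≤ _ := by gcongr
    have h6 : c * (r ^ 3 - rp ^ 3) ≤ l * (r ^ 3 - rp ^ 3) :=
      mul_le_mul_of_nonneg_right h1 (by linarith)
    have h7 : l * (r ^ 3 + 3 * rp ^ 3) ≤ l * (r ^ 3 + rp * r ^ 2 + rp ^ 2 * r + rp ^ 3) := by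
      gcongr ?_ * ?_
      linarith
    have h8 : k = rp + 2 * l * rp ^ 3 - Mc := by rw [hk]; ring
    unfold Cf
    have := hM.2
    nlinarith
  have main : ∀ φ : ℂ →L[ℝ] ℝ, ∀ r, rp < r → φ (ψ Mc r) = 0 := by
    intro φ
    have hφ : ∀ (x : ℝ) (z : ℂ), φ ((x : ℂ) * z) = x * φ z := by
      intro x z
      have := φ.map_smul x z
      rwa [Complex.real_smul, smul_eq_mul] at this
    have H : Fam l rp α q0 (3 / 2 - Δ) (2 * Δ / 3) Mc η (min l (k / rp ^ 3))
        (2 * (|Mc| + η) * rp + rp ^ 2 + l * rp ^ 4) (|Mc| + η)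
        (fun M r => φ (ψ M r)) (fun M r => φ (deriv (ψ M) r)) (fun M => φ (B M)) := by
      have hm : ∀ M ∈ Ico Mc (Mc + η), |M| ≤ |Mc| + η := by
        intro M hM
        have h1 : |M - Mc| ≤ η := by rw [abs_of_nonneg] <;> linarith [hM.1, hM.2]
        have := abs_sub_abs_le_abs_sub M Mc
        linarith
      refine ⟨hl0, hrp, by linarith, by linarith, by ring, by nlinarith, hc0, hη0, hC, ?_, hm, ?_,
        ?_, ?_, ?_, ?_, ?_⟩
      · intro M hM
        have h1 := hm M hM
        rw [abs_le] at h1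
        unfold ef
        have h2 : 0 < l * rp ^ 4 := by positivity
        rw [abs_le]; constructor <;> nlinarith
      · unfold ef
        nlinarith
      · intro M hM r hr
        have h1 := ((hsm M (hmem M hM)).differentiableOn (by norm_num)).differentiableAt
          (Ioi_mem_nhds hr)
        exact φ.hasFDerivAt.comp_hasDerivAt r h1.hasDerivAt
      · intro M hM r hr
        have hr0 := hrp.trans hr
        have h1 := ((hsm M (hmem M hM)).deriv_of_isOpen isOpen_Ioi
          (show (1 : WithTop ℕ∞) + 1 ≤ 2 by norm_num)).differentiableOn (by norm_num)
        have h2 := (h1.differentiableAt (Ioi_mem_nhds hr)).hasDerivAt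
        have h3 := ((Pf_deriv l rp M r).ofReal_comp.mul h2)
        have heq : (fun s : ℝ => (s : ℂ) ^ 2 * ((Om2 rp Λ M s : ℝ) : ℂ) * deriv (ψ M) s)
            =ᶠ[𝓝 r] (fun s : ℝ => ((Pf l rp M s : ℝ) : ℂ)) * deriv (ψ M) := by
          filter_upwards [Ioi_mem_nhds hr] with t ht
          have ht0 : 0 < t := hrp.trans ht
          simp only [Pi.mul_apply]
          rw [hl, ← Om2_eq hrp.ne' ht0.ne']
          push_cast
          ring
        have h4 := hode M (hmem M hM) r hr
        rw [heq.deriv_eq] at h4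
        have h5 := h3.differentiableAt.hasDerivAt
        rw [h4] at h5
        have h6 := φ.hasFDerivAt.comp_hasDerivAt r h5
        have hCp : Cf l rp M r ≠ 0 := by
          have := hC M hM r hr
          exact (lt_of_lt_of_le (by positivity) this).ne'
        have h7 := V_eq (Λ := Λ) (α := α) (q := q0) (M := M) hrp.ne' hr0.ne' (sub_pos.2 hr).ne' hCp
        refine (h6.congr_deriv ?_).congr_of_eventuallyEq (Eventually.of_forall fun t => ?_)
        · rw [hl, ← h7, ← hφ]
          push_cast
          rfl
        · simp only [Function.comp, Pi.mul_apply]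
          rw [hφ]
      · intro M hM
        obtain ⟨L, hL⟩ := hreg M (hmem M hM)
        exact ⟨φ L, (φ.continuous.tendsto L).comp hL⟩
      · intro M hM
        have := (φ.continuous.tendsto (B M)).comp (hB M (hmem M hM))
        refine this.congr fun r => ?_
        simp only [Function.comp, map_smul, smul_eq_mul]
      · intro r hr
        exact ((φ.continuous.tendsto _).comp (hdiffM r hr).continuousAt.tendsto).mono_left
          nhdsWithin_le_nhds
    refine H.core ?_ ?_
    · simp [hstat]
    · have h : HasDerivAt (fun M => φ (B M)) (φ 0) Mc :=
        φ.hasFDerivAt.comp_hasDerivAt Mc hBd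
      exact h.congr_deriv (map_zero φ)
  obtain ⟨r, hr, hne⟩ := hnt
  apply hne
  apply Complex.ext
  · simpa using main Complex.reCLM r hr
  · simpa using main Complex.imCLM r hr
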